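/- Let F be a fragment of intuitionistic propositional logic with {∨, ¬} ⊆ F. Suppose F has a finite semantics with n ≥ 1 values, i.e., there is an algebra with finite universe V of cardinality n carrying an operation for each connective in F and a subset D ⊆ V such that for all Γ ∪ {φ} ⊆ 𝔉_F, Γ ⊢_F φ iff Γ ⊨_{A,D} φ. Then the formula α_n = ⋁_{1 ≤ i < j ≤ n+1} ¬¬(¬p_i ∨ p_j) (the disjunction over all pairs 1 ≤ i < j ≤ n+1 of the formulas ¬¬(¬p_i ∨ p_j)) is derivable: ⊢_F α_n. -/

import Mathlib

/-- The four propositional connectives. -/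
inductive Conn : Type
  | conj | disj | impl | nega
deriving DecidableEq

/-- Propositional formulas over countably many letters `p₀, p₁, …`. -/
inductive PropForm : Type
  | var : ℕ → PropForm
  | and : PropForm → PropForm → PropForm
  | or : PropForm → PropForm → PropForm
  | imp : PropForm → PropForm → PropForm
  | neg : PropForm → PropForm

/-- The set of connectives occurring in a formula. -/
def PropForm.conns : PropForm → Set Conn
  | .var _ => ∅
  | .and a b => insert .conj (a.conns ∪ b.conns)
  | .or a b => insert .disj (a.conns ∪ b.conns)
  | .imp a b => insert .impl (a.conns ∪ b.conns)
  | .neg a => insert .nega a.conns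

/-- `φ ∈ 𝔉_F` : the formula `φ` uses only connectives belonging to the fragment `F`. -/
def InFrag (F : Set Conn) (φ : PropForm) : Prop := φ.conns ⊆ F

/-- Derivability `Γ ⊢_F φ` for the fragment `F`: the least relation closed under
membership, monotonicity, cut, and the two directions of the rules
(R∧), (R∨), (R→), (R¬I), (R¬E) for the connectives in `F`. -/
inductive Deriv (F : Set Conn) : Set PropForm → PropForm → Prop
  | mem {Γ : Set PropForm} {φ : PropForm} : φ ∈ Γ → Deriv F Γ φ
  | mono {Γ : Set PropForm} {φ ψ : PropForm} : Deriv F Γ φ → Deriv F (insert ψ Γ) φ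
  | cut {Γ Δ : Set PropForm} {φ ψ : PropForm} :
      Deriv F Γ φ → Deriv F (insert φ Δ) ψ → Deriv F (Γ ∪ Δ) ψ
  | andI {Γ : Set PropForm} {φ ψ : PropForm} :
      Conn.conj ∈ F → Deriv F Γ φ → Deriv F Γ ψ → Deriv F Γ (.and φ ψ)
  | andE1 {Γ : Set PropForm} {φ ψ : PropForm} :
      Conn.conj ∈ F → Deriv F Γ (.and φ ψ) → Deriv F Γ φ
  | andE2 {Γ : Set PropForm} {φ ψ : PropForm} :
      Conn.conj ∈ F → Deriv F Γ (.and φ ψ) → Deriv F Γ ψ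
  | orI {Γ : Set PropForm} {φ ψ χ : PropForm} :
      Conn.disj ∈ F → Deriv F (insert φ Γ) χ → Deriv F (insert ψ Γ) χ →
      Deriv F (insert (.or φ ψ) Γ) χ
  | orE1 {Γ : Set PropForm} {φ ψ χ : PropForm} :
      Conn.disj ∈ F → Deriv F (insert (.or φ ψ) Γ) χ → Deriv F (insert φ Γ) χ
  | orE2 {Γ : Set PropForm} {φ ψ χ : PropForm} :
      Conn.disj ∈ F → Deriv F (insert (.or φ ψ) Γ) χ → Deriv F (insert ψ Γ) χ
  | impI {Γ : Set PropForm} {φ ψ : PropForm} :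
      Conn.impl ∈ F → Deriv F (insert φ Γ) ψ → Deriv F Γ (.imp φ ψ)
  | impE {Γ : Set PropForm} {φ ψ : PropForm} :
      Conn.impl ∈ F → Deriv F Γ (.imp φ ψ) → Deriv F (insert φ Γ) ψ
  | negI {Γ : Set PropForm} {φ ψ : PropForm} :
      Conn.nega ∈ F → Deriv F (insert φ Γ) ψ → Deriv F (insert φ Γ) (.neg ψ) →
      Deriv F Γ (.neg φ)
  | negE {Γ : Set PropForm} {φ ψ : PropForm} :
      Conn.nega ∈ F → Deriv F Γ φ → Deriv F Γ (.neg φ) → Deriv F Γ ψ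

/-- An algebra interpreting the connectives on a carrier `V`. -/
structure Alg (V : Type) where
  and : V → V → V
  or : V → V → V
  imp : V → V → V
  neg : V → V

/-- The homomorphic extension of an assignment `v` of letters. -/
def Alg.eval {V : Type} (A : Alg V) (v : ℕ → V) : PropForm → V
  | .var n => v n
  | .and a b => A.and (A.eval v a) (A.eval v b)
  | .or a b => A.or (A.eval v a) (A.eval v b)
  | .imp a b => A.imp (A.eval v a) (A.eval v b)
  | .neg a => A.neg (A.eval v a)

/-- Semantic consequence `Γ ⊨_{A,D} φ`. -/
def SemConseq {V : Type} (A : Alg V) (D : Set V) (Γ : Set PropForm) (φ : PropForm) : Prop :=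
  ∀ v : ℕ → V, (∀ ψ ∈ Γ, A.eval v ψ ∈ D) → A.eval v φ ∈ D

/-- The fragment `F` has a finite semantics. -/
def HasFiniteSemantics (F : Set Conn) : Prop :=
  ∃ (V : Type) (_ : Fintype V) (A : Alg V) (D : Set V),
    ∀ (Γ : Set PropForm) (φ : PropForm),
      (∀ ψ ∈ Γ, InFrag F ψ) → InFrag F φ →
      (Deriv F Γ φ ↔ SemConseq A D Γ φ)

/-- `φ ∨̇ ψ = (φ → ψ) → ψ`. -/
def dvee (a b : PropForm) : PropForm := .imp (.imp a b) b

/-- Left-associated iterated `∨̇` of a list of formulas. -/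
def bigDvee : List PropForm → PropForm
  | [] => .var 0
  | a :: rest => rest.foldl dvee a

/-- Left-associated iterated `∨` of a list of formulas. -/
def bigOrF : List PropForm → PropForm
  | [] => .var 0
  | a :: rest => rest.foldl PropForm.or a

/-- All pairs `(i, j)` with `1 ≤ i < j ≤ n+1`. -/
def pairs (n : ℕ) : List (ℕ × ℕ) :=
  (List.range' 2 n).flatMap fun j => (List.range' 1 (j - 1)).map fun i => (i, j)

/-- `α_n = ∨̇_{1 ≤ i < j ≤ n+1} (p_j → p_i)`. -/
def alphaImp (n : ℕ) : PropForm :=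
  bigDvee ((pairs n).map fun p => .imp (.var p.2) (.var p.1))

/-- `α_n = ⋁_{1 ≤ i < j ≤ n+1} ¬¬(¬p_i ∨ p_j)`. -/
def alphaOrNeg (n : ℕ) : PropForm :=
  bigOrF ((pairs n).map fun p => .neg (.neg (.or (.neg (.var p.1)) (.var p.2))))

/-- Two-valued Boolean evaluation. -/
def evalBool (v : ℕ → Bool) : PropForm → Bool
  | .var n => v n
  | .and a b => evalBool v a && evalBool v b
  | .or a b => evalBool v a || evalBool v b
  | .imp a b => !evalBool v a || evalBool v b
  | .neg a => !evalBool v a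

/-- Classical (two-valued) consequence `Γ ⊢_c φ`. -/
def ClassConseq (Γ : Set PropForm) (φ : PropForm) : Prop :=
  ∀ v : ℕ → Bool, (∀ ψ ∈ Γ, evalBool v ψ = true) → evalBool v φ = true

/-- The two-element Boolean algebra `𝟐`. -/
def alg2 : Alg Bool where
  and a b := a && b
  or a b := a || b
  imp a b := !a || b
  neg a := !a

/-- The three-element algebra `𝟑` on the chain `0 < 1/2 < 1` (coded as `0 < 1 < 2` in `Fin 3`),
with meet `min` and meet complement `¬0 = 1`, `¬(1/2) = ¬1 = 0` (its `or`/`imp` are those of the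
3-element Heyting chain). -/
def alg3 : Alg (Fin 3) where
  and a b := min a b
  or a b := max a b
  imp a b := if a ≤ b then 2 else b
  neg a := if a = 0 then 2 else 0

/-- The `(n+1)`-element Heyting chain, coded on `Fin (n+1)` (so `k` codes the element `k+1`). -/
def chainAlg (n : ℕ) : Alg (Fin (n + 1)) where
  and a b := min a b
  or a b := max a b
  imp a b := if a ≤ b then Fin.last n else b
  neg a := if a = 0 then Fin.last n else 0

/-- The formula `¬¬(¬φ ∨ ψ)`, classically equivalent to the implication from `φ` to `ψ`. -/
def nnImp (φ ψ : PropForm) : PropForm := .neg (.neg (.or (.neg φ) ψ))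

namespace Deriv

variable {F : Set Conn} {Γ : Set PropForm} {φ ψ : PropForm}

theorem cut_self (h₁ : Deriv F Γ φ) (h₂ : Deriv F (insert φ Γ) ψ) : Deriv F Γ ψ := by
  simpa using h₁.cut h₂

theorem or_left (hd : Conn.disj ∈ F) (h : Deriv F Γ φ) : Deriv F Γ (.or φ ψ) :=
  h.cut_self (orE1 hd (mem (Set.mem_insert _ _)))

theorem or_right (hd : Conn.disj ∈ F) (h : Deriv F Γ ψ) : Deriv F Γ (.or φ ψ) :=
  h.cut_self (orE2 hd (mem (Set.mem_insert _ _)))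

theorem nnImp_self (hd : Conn.disj ∈ F) (hn : Conn.nega ∈ F) : Deriv F Γ (nnImp φ φ) := by
  have hneg : Deriv F (insert (.neg (.or (.neg φ) φ)) Γ) (.neg φ) :=
    negI hn (ψ := .or (.neg φ) φ) (or_right hd (mem (by simp))) (mem (by simp))
  exact negI hn (ψ := .or (.neg φ) φ) (or_left hd hneg) (mem (by simp))

theorem foldl_or (hd : Conn.disj ∈ F) {L : List PropForm} {a : PropForm}
    (h : Deriv F Γ a ∨ ∃ ψ ∈ L, Deriv F Γ ψ) : Deriv F Γ (L.foldl .or a) := by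
  induction L generalizing a with
  | nil => simpa using h
  | cons b L ih =>
    refine ih ?_
    rcases h with h | ⟨ψ, hψ, h⟩
    · exact .inl (or_left hd h)
    · rcases List.mem_cons.1 hψ with rfl | hψ
      · exact .inl (or_right hd h)
      · exact .inr ⟨ψ, hψ, h⟩

theorem bigOrF_of_mem (hd : Conn.disj ∈ F) {L : List PropForm} (hL : ψ ∈ L)
    (h : Deriv F Γ ψ) : Deriv F Γ (bigOrF L) := by
  cases L with
  | nil => simp at hL
  | cons a L =>
    refine foldl_or hd ?_
    rcases List.mem_cons.1 hL with rfl | hL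
    · exact .inl h
    · exact .inr ⟨ψ, hL, h⟩

end Deriv

theorem inFrag_or {F : Set Conn} {φ ψ : PropForm} (hd : Conn.disj ∈ F) (hφ : InFrag F φ)
    (hψ : InFrag F ψ) : InFrag F (.or φ ψ) :=
  Set.insert_subset hd (Set.union_subset hφ hψ)

theorem inFrag_neg {F : Set Conn} {φ : PropForm} (hn : Conn.nega ∈ F) (hφ : InFrag F φ) :
    InFrag F (.neg φ) :=
  Set.insert_subset hn hφ

theorem inFrag_var (F : Set Conn) (k : ℕ) : InFrag F (.var k) :=
  Set.empty_subset F

theorem inFrag_bigOrF {F : Set Conn} (hd : Conn.disj ∈ F) {L : List PropForm}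
    (hL : ∀ ψ ∈ L, InFrag F ψ) : InFrag F (bigOrF L) := by
  cases L with
  | nil => exact inFrag_var F 0
  | cons a L =>
    change InFrag F (L.foldl .or a)
    induction L generalizing a with
    | nil => exact hL a (by simp)
    | cons b L ih =>
      refine ih _ fun ψ hψ => ?_
      rcases List.mem_cons.1 hψ with rfl | hψ
      · exact inFrag_or hd (hL _ (by simp)) (hL _ (by simp))
      · exact hL ψ (by simp [hψ])

theorem Alg.eval_foldl_or {V : Type} (A : Alg V) (v : ℕ → V) (L : List PropForm)
    (a : PropForm) : A.eval v (L.foldl .or a) = (L.map (A.eval v)).foldl A.or (A.eval v a) := by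
  induction L generalizing a with
  | nil => rfl
  | cons b L ih => exact ih _

theorem Alg.eval_bigOrF_map_congr {V ι : Type} (A : Alg V) (v : ℕ → V) {L : List ι}
    {f g : ι → PropForm} (hL : L ≠ []) (h : ∀ x, A.eval v (f x) = A.eval v (g x)) :
    A.eval v (bigOrF (L.map f)) = A.eval v (bigOrF (L.map g)) := by
  cases L with
  | nil => exact absurd rfl hL
  | cons a L => simp [bigOrF, Alg.eval_foldl_or, Function.comp_def, h]

theorem mem_pairs {n i j : ℕ} (hi : 1 ≤ i) (hij : i < j) (hj : j ≤ n + 1) :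
    (i, j) ∈ pairs n := by
  simp only [pairs, List.mem_flatMap, List.mem_map, List.mem_range'_1, Prod.mk.injEq]
  exact ⟨j, by omega, i, by omega, rfl, rfl⟩

theorem exists_lt_eq_of_card {V : Type} [Fintype V] (v : ℕ → V) :
    ∃ i j, 1 ≤ i ∧ i < j ∧ j ≤ Fintype.card V + 1 ∧ v i = v j := by
  obtain ⟨i, hi, j, hj, hne, he⟩ :=
    Finset.exists_ne_map_eq_of_card_lt_of_maps_to
      (s := Finset.Icc 1 (Fintype.card V + 1)) (t := Finset.univ) (f := v)
      (by simp) (by simp)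
  simp only [Finset.mem_Icc] at hi hj
  rcases hne.lt_or_gt with h | h
  · exact ⟨i, j, hi.1, h, hj.2, he⟩
  · exact ⟨j, i, hj.1, h, hi.2, he.symm⟩

/-- if `{∨, ¬} ⊆ F` and `F` has a finite semantics with `n ≥ 1`
values, then `⊢_F α_n` where `α_n = ⋁_{1 ≤ i < j ≤ n+1} ¬¬(¬p_i ∨ p_j)`. -/
theorem finite_semantics_disj_neg_alpha (F : Set Conn)
    (hd : Conn.disj ∈ F) (hn' : Conn.nega ∈ F) (n : ℕ) (hn : 1 ≤ n)
    (V : Type) [instV : Fintype V] (hcard : Fintype.card V = n) (A : Alg V) (D : Set V)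
    (hsem : ∀ (Γ : Set PropForm) (φ : PropForm),
      (∀ ψ ∈ Γ, InFrag F ψ) → InFrag F φ → (Deriv F Γ φ ↔ SemConseq A D Γ φ)) :
    Deriv F ∅ (alphaOrNeg n) := by
  have hfrag (σ : ℕ → ℕ) : InFrag F
      (bigOrF ((pairs n).map fun p => nnImp (.var (σ p.1)) (.var (σ p.2)))) := by
    refine inFrag_bigOrF hd fun ψ hψ => ?_
    obtain ⟨p, -, rfl⟩ := List.mem_map.1 hψ
    exact inFrag_neg hn' (inFrag_neg hn'
      (inFrag_or hd (inFrag_neg hn' (inFrag_var F _)) (inFrag_var F _)))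
  refine (hsem ∅ (alphaOrNeg n) (by simp) (hfrag id)).2 fun v hv => ?_
  obtain ⟨i, j, hi, hij, hj, he⟩ := exists_lt_eq_of_card v
  rw [hcard] at hj
  have hmem := mem_pairs hi hij hj
  let σ : ℕ → ℕ := Function.update id j i
  have hσ (k : ℕ) : v (σ k) = v k := by
    by_cases hk : k = j
    · simp [σ, hk, he]
    · simp [σ, hk]
  have hder : Deriv F ∅
      (bigOrF ((pairs n).map fun p => nnImp (.var (σ p.1)) (.var (σ p.2)))) := by
    refine Deriv.bigOrF_of_mem hd (List.mem_map_of_mem hmem) ?_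
    have : σ i = σ j := by simp [σ, hij.ne]
    rw [this]
    exact Deriv.nnImp_self hd hn'
  have hD := (hsem ∅ _ (by simp) (hfrag σ)).1 hder v hv
  rwa [A.eval_bigOrF_map_congr v (List.ne_nil_of_mem hmem)
    (g := fun p => nnImp (.var p.1) (.var p.2))
    (fun p => by simp [nnImp, Alg.eval, hσ])] at hD
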